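/- Let K be a field of odd characteristic and let f ∈ K[X] be an additive polynomial with f'(0) ≠ 0. If G, H ∈ K[X] satisfy G ∘ H = X·f(X), then either deg(G) = 1, or deg(H) = 1, or H = L ∘ X² for some polynomial L ∈ K[X] of degree one. -/

import Mathlib

open Polynomial

/-- A polynomial `f ∈ K[X]` is additive if `f(X+Y) = f(X) + f(Y)` holds as an identity
of polynomials in two variables over `K`. -/
def IsAdditive {K : Type*} [CommSemiring K] (f : Polynomial K) : Prop :=
    Polynomial.aeval ((Polynomial.C Polynomial.X + Polynomial.X : Polynomial (Polynomial K))) f =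
      Polynomial.aeval ((Polynomial.C Polynomial.X : Polynomial (Polynomial K))) f +
        Polynomial.aeval ((Polynomial.X : Polynomial (Polynomial K))) f

theorem IsAdditive.derivative_eq_C {K : Type*} [CommRing K] {f : K[X]} (hf : IsAdditive f) :
    derivative f = C (eval 0 (derivative f)) := by
  have key : ∀ q : K[X][X], aeval q f = (f.map C).comp q := fun q => by
    rw [comp, eval₂_map, aeval_def]
    rfl
  unfold IsAdditive at hf
  rw [key, key, key] at hf
  have h := congrArg (fun q => eval 0 (derivative q)) hf
  simpa [derivative_comp, derivative_map, eval_comp, eval_map, eval₂_C_X, eval₂_at_zero,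
    coeff_zero_eq_eval_zero] using h

/-- If `f'` is a nonzero constant, any inner factor in a decomposition of `X * f` whose outer
factor has a critical point is, up to a translation, at most quadratic and even. -/
theorem natDegree_le_two_of_comp_eq_X_mul {A : Type*} [Field A] [IsAlgClosed A] {a : A}
    (ha : a ≠ 0) (h2 : (2 : A) ≠ 0) {f G H : A[X]} (hf : derivative f = C a)
    (hGH : G.comp H = X * f) (hG : (derivative G).natDegree ≠ 0) (hH : H.natDegree ≠ 0) :
    H.natDegree ≤ 2 ∧ (H.natDegree = 2 → H.coeff 1 = 0) := by
  have hd : derivative H * (derivative G).comp H = f + X * C a := by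
    rw [← derivative_comp, hGH, derivative_mul, derivative_X, one_mul, hf]
  have hsep : (f + X * C a).Separable := by
    rw [Separable, derivative_add, derivative_mul, hf, derivative_X, derivative_C]
    refine IsCoprime.symm (IsCoprime.of_isCoprime_of_dvd_left (y := 1) isCoprime_one_left ?_)
    refine IsUnit.dvd ?_
    rw [one_mul, mul_zero, add_zero, ← C_add, isUnit_C, ← two_mul]
    exact (mul_ne_zero h2 ha).isUnit
  obtain ⟨c, hc⟩ := IsAlgClosed.exists_root (derivative G)
    (fun h => hG (natDegree_eq_of_degree_eq_some h))
  have hdvd : H - C c ∣ f + X * C a := by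
    rw [← hd]
    refine Dvd.dvd.mul_left ?_ _
    obtain ⟨q, hq⟩ := dvd_iff_isRoot.mpr hc
    exact ⟨q.comp H, by rw [hq, mul_comp, sub_comp, X_comp, C_comp]⟩
  have hroots : ∀ x, x ∈ (H - C c).roots → eval x H = c ∧ G.eval c = -a * x ^ 2 := by
    intro x hx
    have hx' : eval x H = c := by
      simpa [sub_eq_zero] using isRoot_of_mem_roots hx
    have h1 : eval x (f + X * C a) = 0 := (isRoot_of_mem_roots hx).dvd hdvd
    have h3 : eval x (G.comp H) = eval x (X * f) := by rw [hGH]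
    simp only [eval_comp, hx', eval_mul, eval_X, eval_add, eval_C] at h1 h3
    exact ⟨hx', by linear_combination h3 + x * h1⟩
  classical
  have hcard : (H - C c).roots.toFinset.card = H.natDegree := by
    rw [Multiset.toFinset_card_of_nodup (nodup_roots (hsep.of_dvd hdvd)),
      ← (IsAlgClosed.splits (H - C c)).natDegree_eq_card_roots, natDegree_sub_C]
  obtain ⟨x, hx⟩ : (H - C c).roots.toFinset.Nonempty := by
    rw [← Finset.card_ne_zero, hcard]
    exact hH
  have hxr := hroots x (Multiset.mem_toFinset.mp hx)
  have hsub : (H - C c).roots.toFinset ⊆ {x, -x} := by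
    intro y hy
    have hyr := hroots y (Multiset.mem_toFinset.mp hy)
    have : y ^ 2 = x ^ 2 := mul_left_cancel₀ ha (by linear_combination hyr.2 - hxr.2)
    simpa using sq_eq_sq_iff_eq_or_eq_neg.mp this
  refine ⟨hcard ▸ (Finset.card_le_card hsub).trans Finset.card_le_two, fun hH2 => ?_⟩
  have heq := Finset.eq_of_subset_of_card_le hsub (by
    rw [hcard, hH2]
    exact Finset.card_le_two)
  have hneg : eval (-x) H = c :=
    (hroots (-x) (Multiset.mem_toFinset.mp (heq ▸ by simp))).1
  have hx0 : x ≠ 0 := by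
    rintro rfl
    rw [heq] at hcard
    simp [hH2] at hcard
  have hev := hneg.trans hxr.1.symm
  rw [eval_eq_sum_range, eval_eq_sum_range, hH2] at hev
  simp only [Finset.sum_range_succ, Finset.sum_range_zero] at hev
  have : 2 * x * H.coeff 1 = 0 := by linear_combination -hev
  simpa [h2, hx0] using this

/-- Over a field of odd characteristic, if `f` is additive with `f'(0) ≠ 0` and
`G ∘ H = X·f(X)`, then `deg G = 1`, or `deg H = 1`, or `H = L ∘ X²` for some degree-one
polynomial `L ∈ K[X]`. -/
theorem statement10 {K : Type*} [Field K] (p : ℕ) [CharP K p] (hp : Odd p)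
    (f : K[X]) (hf : IsAdditive f) (hf0 : eval 0 (derivative f) ≠ 0)
    (G H : K[X]) (hGH : G.comp H = X * f) :
    G.natDegree = 1 ∨ H.natDegree = 1 ∨
      ∃ L : K[X], L.natDegree = 1 ∧ H = L.comp (X ^ 2) := by
  have hpr : p.Prime := (CharP.char_is_prime_or_zero K p).resolve_right
    (fun h => by simp [h] at hp)
  have h2 : (2 : K) ≠ 0 := by
    refine Ring.two_ne_zero ?_
    rw [ringChar.eq K p]
    rintro rfl
    exact absurd hp (by decide)
  set a := eval 0 (derivative f) with ha
  have hfa : derivative f = C a := hf.derivative_eq_C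
  have hfd : f.natDegree ≠ 0 := fun h => hf0 (by
    rw [ha, derivative_of_natDegree_zero h, eval_zero])
  have hf00 : f ≠ 0 := fun h => hfd (by simp [h])
  have hdeg : G.natDegree * H.natDegree = f.natDegree + 1 := by
    rw [← natDegree_comp, hGH, natDegree_X_mul hf00]
  by_cases hf1 : f.natDegree = 1
  · rw [hf1] at hdeg
    have := (Nat.dvd_prime Nat.prime_two).mp (Dvd.intro _ hdeg)
    rcases this with h | h
    · exact Or.inl h
    · rw [h] at hdeg
      exact Or.inr (Or.inl (by omega))
  have hcast : (f.natDegree : K) = 0 := by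
    have h := congrArg (fun q => coeff q (f.natDegree - 1)) hfa
    simp only [coeff_derivative, coeff_C] at h
    rw [if_neg (by omega), Nat.sub_add_cancel (by omega), ← Nat.cast_add_one,
      Nat.sub_add_cancel (by omega)] at h
    exact (mul_eq_zero.mp h).resolve_left (leadingCoeff_ne_zero.mpr hf00)
  have hGcast : (G.natDegree : K) ≠ 0 := by
    intro h
    have := congrArg (Nat.cast : ℕ → K) hdeg
    simp [h, hcast] at this
  by_cases hG1 : G.natDegree = 1
  · exact Or.inl hG1
  have hG0 : G.natDegree ≠ 0 := fun h => hGcast (by simp [h])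
  have hH0 : H.natDegree ≠ 0 := fun h => by simp [h] at hdeg
  have hG' : (derivative G).natDegree ≠ 0 := by
    have : G.natDegree - 1 ≤ (derivative G).natDegree := by
      refine le_natDegree_of_ne_zero ?_
      rw [coeff_derivative, Nat.sub_add_cancel (by omega), ← Nat.cast_add_one,
        Nat.sub_add_cancel (by omega)]
      exact mul_ne_zero (leadingCoeff_ne_zero.mpr fun h => hG0 (by simp [h])) hGcast
    omega
  let φ := algebraMap K (AlgebraicClosure K)
  have key := natDegree_le_two_of_comp_eq_X_mul (a := φ a) (f := f.map φ) (G := G.map φ)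
    (H := H.map φ) ((map_ne_zero φ).mpr hf0) (map_ofNat φ 2 ▸ (map_ne_zero φ).mpr h2)
    (by rw [derivative_map, hfa, map_C]) (by rw [← map_comp, hGH, Polynomial.map_mul, map_X])
    (by rwa [derivative_map, natDegree_map]) (by rwa [natDegree_map])
  rw [natDegree_map, coeff_map, map_eq_zero] at key
  by_cases hH1 : H.natDegree = 1
  · exact Or.inr (Or.inl hH1)
  have hH2 : H.natDegree = 2 := by omega
  have hlead : H.coeff 2 ≠ 0 := by
    rw [← hH2]
    exact leadingCoeff_ne_zero.mpr fun h => hH0 (by simp [h])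
  refine Or.inr (Or.inr ⟨C (H.coeff 2) * X + C (H.coeff 0), natDegree_linear hlead, ?_⟩)
  conv_lhs => rw [H.as_sum_range_C_mul_X_pow, hH2]
  simp [Finset.sum_range_succ, key.2 hH2, add_comm]
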